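/- Define the perfection index I_P = (1/M) · Σᵢ |m1 i − m0 i|. Then I_P = max over all prediction vectors p of a(p) minus min over all prediction vectors p of a(p). -/

import Mathlib

open Finset

theorem perfection_index_eq_max_sub_min (NB : ℕ) (m0 m1 : Fin NB → ℕ)
    (hM : 0 < ∑ i, (m0 i + m1 i)) (amax amin : ℚ)
    (hmax : IsGreatest
      {a : ℚ | ∃ p : Fin NB → ℕ, (∀ i, p i ≤ 1) ∧
        a = (∑ i, ((m1 i : ℚ) * (p i : ℚ) + (m0 i : ℚ) * (1 - (p i : ℚ)))) /
            ((∑ i, (m0 i + m1 i) : ℕ) : ℚ)} amax)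
    (hmin : IsLeast
      {a : ℚ | ∃ p : Fin NB → ℕ, (∀ i, p i ≤ 1) ∧
        a = (∑ i, ((m1 i : ℚ) * (p i : ℚ) + (m0 i : ℚ) * (1 - (p i : ℚ)))) /
            ((∑ i, (m0 i + m1 i) : ℕ) : ℚ)} amin) :
    ((∑ i, |(m1 i : ℤ) - (m0 i : ℤ)| : ℤ) : ℚ) /
      ((∑ i, (m0 i + m1 i) : ℕ) : ℚ) = amax - amin := by
  have h1 := hmax.unique (b := (∑ i, max (m1 i : ℚ) (m0 i : ℚ)) / ((∑ i, (m0 i + m1 i) : ℕ) : ℚ)) (by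
    constructor
    · refine ⟨fun i => if m0 i ≤ m1 i then 1 else 0, fun i => by dsimp only; split_ifs <;> simp, ?_⟩
      congr 1
      refine Finset.sum_congr rfl fun i _ => ?_
      by_cases h : m0 i ≤ m1 i
      · have h' : (m0 i : ℚ) ≤ m1 i := by exact_mod_cast h
        simp [h]
      · have h' : (m1 i : ℚ) ≤ m0 i := by exact_mod_cast (not_le.mp h).le
        simp [h, (not_le.mp h).le]
    · rintro a ⟨p, hp, rfl⟩
      refine div_le_div_of_nonneg_right (Finset.sum_le_sum fun i _ => ?_) (Nat.cast_nonneg _)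
      rcases Nat.le_one_iff_eq_zero_or_eq_one.mp (hp i) with h | h <;> simp [h])
  have h2 := hmin.unique (b := (∑ i, min (m1 i : ℚ) (m0 i : ℚ)) / ((∑ i, (m0 i + m1 i) : ℕ) : ℚ)) (by
    constructor
    · refine ⟨fun i => if m0 i ≤ m1 i then 0 else 1, fun i => by dsimp only; split_ifs <;> simp, ?_⟩
      congr 1
      refine Finset.sum_congr rfl fun i _ => ?_
      by_cases h : m0 i ≤ m1 i
      · have h' : (m0 i : ℚ) ≤ m1 i := by exact_mod_cast h
        simp [h]
      · have h' : (m1 i : ℚ) ≤ m0 i := by exact_mod_cast (not_le.mp h).le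
        simp [h, (not_le.mp h).le]
    · rintro a ⟨p, hp, rfl⟩
      refine div_le_div_of_nonneg_right (Finset.sum_le_sum fun i _ => ?_) (Nat.cast_nonneg _)
      rcases Nat.le_one_iff_eq_zero_or_eq_one.mp (hp i) with h | h <;> simp [h])
  rw [h1, h2, ← sub_div, ← Finset.sum_sub_distrib]
  congr 1
  rw [Int.cast_sum]
  refine Finset.sum_congr rfl fun i _ => ?_
  rw [max_sub_min_eq_abs']
  push_cast
  rfl
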